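/- Let T ≥ 1 be an integer and assume vol X^∞ = vol cl(X^∞). If the dual LP admits a feasible point (u, v, w) with u = 0 whose objective value ∫_X w dλ_X equals the dual optimal value d^T, then Σ_{t=0}^{∞} t · vol Y^t ≤ T · vol X (in particular Σ_{t=0}^{∞} t · vol Y^t < ∞) and p^T = d^T = vol X^∞. -/

import Mathlib

open MeasureTheory
open scoped ENNReal

/-- Feasibility for the primal LP. -/
def PrimalFeasible (n : ℕ) (f : (Fin n → ℝ) → (Fin n → ℝ))
    (X0 X : Set (Fin n → ℝ)) (T : ℕ)
    (μ₀ μ μh ν : Measure (Fin n → ℝ)) (a : ℝ≥0∞) : Prop :=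
  IsFiniteMeasure μ₀ ∧ IsFiniteMeasure μ ∧ IsFiniteMeasure μh ∧ IsFiniteMeasure ν ∧
  μ₀ X0ᶜ = 0 ∧ μ Xᶜ = 0 ∧ μh Xᶜ = 0 ∧ ν Xᶜ = 0 ∧
  ν Set.univ + a = (T : ℝ≥0∞) * volume X ∧
  μ + ν = Measure.map f ν + μ₀ ∧
  μ + μh = volume.restrict X

/-- Optimal value of the primal LP (as a real number). -/
noncomputable def primalValue (n : ℕ) (f : (Fin n → ℝ) → (Fin n → ℝ))
    (X0 X : Set (Fin n → ℝ)) (T : ℕ) : ℝ :=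
  sSup {r : ℝ | ∃ μ₀ μ μh ν a, PrimalFeasible n f X0 X T μ₀ μ μh ν a ∧
    r = (μ Set.univ).toReal}

/-- Feasibility for the dual LP. -/
def DualFeasible (n : ℕ) (f : (Fin n → ℝ) → (Fin n → ℝ))
    (X0 X : Set (Fin n → ℝ)) (u : ℝ) (v w : (Fin n → ℝ) → ℝ) : Prop :=
  0 ≤ u ∧ Continuous v ∧ Continuous w ∧
  (∀ x ∈ X0, 0 ≤ v x) ∧
  (∀ x ∈ X, 1 + v x ≤ w x) ∧
  (∀ x ∈ X, 0 ≤ w x) ∧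
  (∀ x ∈ X, v x ≤ u + v (f x))

/-- Optimal value of the dual LP. -/
noncomputable def dualValue (n : ℕ) (f : (Fin n → ℝ) → (Fin n → ℝ))
    (X0 X : Set (Fin n → ℝ)) (T : ℕ) : ℝ :=
  sInf {r : ℝ | ∃ u v w, DualFeasible n f X0 X u v w ∧
    r = ∫ x in X, (w x + (T : ℝ) * u)}

/-- Duality for a cone program whose minimum is attained: the optimal multiplier is a positive
linear functional. -/
theorem exists_positive_multiplier {W Z : Type*} [AddCommGroup W] [Module ℝ W]
    [AddCommGroup Z] [PartialOrder Z] [IsOrderedAddMonoid Z] [Module ℝ Z] [PosSMulMono ℝ Z]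
    (A : W →ₗ[ℝ] Z) (c : W →ₗ[ℝ] ℝ) (b : Z) (y : W) (hy : b ≤ A y)
    (hmin : ∀ x, b ≤ A x → c y ≤ c x) (hdom : ∀ z, ∃ x, z ≤ A x) :
    ∃ g : Z →ₗ[ℝ] ℝ, (∀ z, 0 ≤ z → 0 ≤ g z) ∧ (∀ x, g (A x) = c x) ∧ g b = c y := by
  have key : ∀ (x : W) (t : ℝ), t • b ≤ A x → t * c y ≤ c x := by
    intro x t hx
    rcases lt_or_ge 0 t with ht | ht
    · have h1 : b ≤ A (t⁻¹ • x) := by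
        have := smul_le_smul_of_nonneg_left hx (inv_nonneg.2 ht.le)
        rwa [smul_smul, inv_mul_cancel₀ ht.ne', one_smul, ← map_smul] at this
      have h2 := hmin _ h1
      rw [map_smul, smul_eq_mul, ← div_eq_inv_mul, le_div_iff₀ ht] at h2
      linarith
    · have h1 : b ≤ A (y + (x + (-t) • y)) := by
        have h := add_le_add hx (smul_le_smul_of_nonneg_left hy (neg_nonneg.2 ht))
        rw [← add_smul, add_neg_cancel, zero_smul] at h
        rw [map_add, map_add, map_smul]
        exact hy.trans (le_add_of_nonneg_right h)
      have h2 := hmin _ h1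
      rw [map_add, map_add, map_smul, smul_eq_mul] at h2
      linarith
  let L : (W × ℝ) × Z →ₗ[ℝ] Z :=
    (A.coprod (LinearMap.toSpanSingleton ℝ Z (-b))).coprod LinearMap.id
  let C : PointedCone ℝ ((W × ℝ) × Z) := (PointedCone.positive ℝ Z).comap L
  let d : W × ℝ →ₗ[ℝ] ℝ := c.coprod (LinearMap.toSpanSingleton ℝ ℝ (-c y))
  let D : Submodule ℝ ((W × ℝ) × Z) := Submodule.prod ⊤ ⊥
  let F : ((W × ℝ) × Z) →ₗ.[ℝ] ℝ :=
    ⟨D, (d.comp (LinearMap.fst ℝ (W × ℝ) Z)).comp D.subtype⟩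
  have hC : ∀ p, p ∈ C ↔ 0 ≤ A p.1.1 + p.1.2 • (-b) + p.2 := fun p => Iff.rfl
  obtain ⟨G, hG, hpos⟩ := riesz_extension C F (by
    rintro ⟨⟨⟨x, t⟩, z⟩, hz⟩ hx
    obtain rfl : z = 0 := by simpa [F, D] using hz
    have h := (hC _).1 hx
    have := key x t (by simpa using h)
    change 0 ≤ c x + t • (-c y)
    simp only [smul_eq_mul]
    linarith) (by
    rintro ⟨⟨x, t⟩, z⟩
    obtain ⟨x', hx'⟩ := hdom (-z)
    refine ⟨⟨((x' - x, -t), 0), by simp [F, D]⟩, (hC _).2 ?_⟩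
    simpa [add_comm, neg_le_iff_add_nonneg] using hx')
  have hG' : ∀ x t, G ((x, t), 0) = c x - t * c y := by
    intro x t
    have := hG ⟨((x, t), 0), by simp [F, D]⟩
    rw [this]
    change c x + t • (-c y) = _
    simp [sub_eq_add_neg]
  have hker : ∀ x t, G (0, A x - t • b) = c x - t * c y := by
    intro x t
    have h1 := hpos ((x, t), -(A x - t • b)) ((hC _).2 (le_of_eq (by simp; abel)))
    have h2 := hpos (-((x, t), -(A x - t • b))) ((hC _).2 (le_of_eq (by simp)))
    rw [map_neg] at h2
    have h3 : (((x, t), -(A x - t • b)) : (W × ℝ) × Z) = ((x, t), 0) - (0, A x - t • b) := by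
      simp
    rw [h3, map_sub, hG'] at h1 h2
    linarith
  refine ⟨G.comp (LinearMap.inr ℝ (W × ℝ) Z), fun z hz => hpos _ ((hC _).2 (by simpa using hz)),
    fun x => by simpa using hker x 0, by simpa using hker 0 (-1)⟩

/-- The Riesz–Markov–Kakutani theorem on a compact subset, with the measure on the whole space. -/
theorem exists_measure_of_positive {E : Type*} [TopologicalSpace E] [T2Space E]
    [MeasurableSpace E] [BorelSpace E] {K : Set E} (hK : IsCompact K)
    (φ : C(K, ℝ) →ₗ[ℝ] ℝ) (hφ : ∀ h, 0 ≤ h → 0 ≤ φ h) :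
    ∃ μ : Measure E, IsFiniteMeasure μ ∧ μ Kᶜ = 0 ∧
      ∀ h : C(E, ℝ), ∫ x, h x ∂μ = φ (h.restrict K) := by
  have : CompactSpace K := isCompact_iff_compactSpace.mp hK
  let Λ : CompactlySupportedContinuousMap K ℝ →ₚ[ℝ] ℝ := PositiveLinearMap.mk₀
    { toFun := fun h => φ h.toContinuousMap
      map_add' := fun a b => φ.map_add a.toContinuousMap b.toContinuousMap
      map_smul' := fun r a => φ.map_smul r a.toContinuousMap }
    (fun h hh => hφ _ hh)
  refine ⟨(RealRMK.rieszMeasure Λ).map Subtype.val, inferInstance, ?_, fun h => ?_⟩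
  · rw [Measure.map_apply measurable_subtype_coe hK.measurableSet.compl]
    simp
  · rw [(MeasurableEmbedding.subtype_coe hK.measurableSet).integral_map]
    exact RealRMK.integral_rieszMeasure (Λ := Λ)
      (CompactlySupportedContinuousMap.continuousMapEquiv (h.restrict K))

theorem integrable_of_continuous_of_compl_null {E : Type*} [TopologicalSpace E] [T2Space E]
    [MeasurableSpace E] [BorelSpace E] {K : Set E} (hK : IsCompact K) {μ : Measure E}
    [IsFiniteMeasure μ] (hμ : μ Kᶜ = 0) {h : E → ℝ} (hh : Continuous h) : Integrable h μ := by
  have h1 : IntegrableOn h K μ := hh.continuousOn.integrableOn_compact hK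
  rwa [IntegrableOn, Measure.restrict_eq_self_of_ae_mem hμ] at h1

theorem exists_primalFeasible_of_dual_minimizer {n : ℕ} {f : (Fin n → ℝ) → (Fin n → ℝ)}
    (hf : Continuous f) {X0 X : Set (Fin n → ℝ)} (hX0 : IsCompact X0) (hX : IsCompact X) {T : ℕ}
    {u : ℝ} {v w : (Fin n → ℝ) → ℝ} (hfeas : DualFeasible n f X0 X u v w)
    (hmin : ∀ u' v' w', DualFeasible n f X0 X u' v' w' →
      ∫ x in X, (w x + T * u) ≤ ∫ x in X, (w' x + T * u')) :
    ∃ μ₀ μ μh ν a, PrimalFeasible n f X0 X T μ₀ μ μh ν a ∧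
      (μ Set.univ).toReal = ∫ x in X, (w x + T * u) := by
  obtain ⟨hu, hv, hw, h1, h2, h3, h4⟩ := hfeas
  have hXfin : volume X ≠ ⊤ := hX.measure_lt_top.ne
  have : IsFiniteMeasure (volume.restrict X) := isFiniteMeasure_restrict.2 hXfin
  have hobj : ∀ (w : (Fin n → ℝ) → ℝ) (u : ℝ), Continuous w →
      ∫ x in X, (w x + T * u) = (∫ x in X, w x) + u * (T * volume.real X) := by
    intro w u hw
    rw [integral_add (hw.continuousOn.integrableOn_compact hX) (integrable_const _),
      integral_const]
    simp
    ring
  let F : C(Fin n → ℝ, Fin n → ℝ) := ⟨f, hf⟩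
  let A : (ℝ × C(Fin n → ℝ, ℝ) × C(Fin n → ℝ, ℝ)) →ₗ[ℝ]
      C(X0, ℝ) × C(X, ℝ) × C(X, ℝ) × C(X, ℝ) × ℝ :=
    { toFun := fun y => (y.2.1.restrict X0,
        (ContinuousMap.const _ y.1 + y.2.1.comp F - y.2.1).restrict X,
        (y.2.2 - y.2.1).restrict X, y.2.2.restrict X, y.1)
      map_add' := fun y z => by
        ext <;> simp <;> ring
      map_smul' := fun r y => by
        ext <;> simp <;> ring }
  let c : (ℝ × C(Fin n → ℝ, ℝ) × C(Fin n → ℝ, ℝ)) →ₗ[ℝ] ℝ :=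
    { toFun := fun y => (∫ x in X, y.2.2 x) + y.1 * (T * volume.real X)
      map_add' := fun y z => by
        simp only [Prod.snd_add, Prod.fst_add, ContinuousMap.add_apply]
        rw [integral_add (y.2.2.continuous.continuousOn.integrableOn_compact hX)
          (z.2.2.continuous.continuousOn.integrableOn_compact hX)]
        ring
      map_smul' := fun r y => by
        simp only [Prod.smul_snd, Prod.smul_fst, ContinuousMap.smul_apply, smul_eq_mul,
          integral_const_mul, RingHom.id_apply]
        ring }
  have hbd : ∀ {K : Set (Fin n → ℝ)}, IsCompact K → ∀ q : C(K, ℝ), ∃ M : ℝ, ∀ x, q x ≤ M := by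
    intro K hK q
    have : CompactSpace K := isCompact_iff_compactSpace.mp hK
    exact ⟨‖q‖, fun x => (le_abs_self _).trans (q.norm_coe_le_norm x)⟩
  have hb : ∀ y : ℝ × C(Fin n → ℝ, ℝ) × C(Fin n → ℝ, ℝ),
      (0, 0, 1, 0, 0) ≤ A y ↔ DualFeasible n f X0 X y.1 y.2.1 y.2.2 := by
    rintro ⟨u, v, w⟩
    simp only [A, LinearMap.coe_mk, AddHom.coe_mk, Prod.mk_le_mk, ContinuousMap.le_def,
      DualFeasible, Subtype.forall]
    simp only [ContinuousMap.restrict_apply, ContinuousMap.add_apply, ContinuousMap.sub_apply,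
      ContinuousMap.const_apply, ContinuousMap.comp_apply, ContinuousMap.zero_apply,
      ContinuousMap.one_apply, le_sub_iff_add_le, v.continuous, w.continuous,
      true_and, zero_add]
    exact ⟨fun ⟨a, b, c, d, e⟩ => ⟨e, a, c, d, b⟩, fun ⟨e, a, c, d, b⟩ => ⟨a, b, c, d, e⟩⟩
  obtain ⟨g, hg0, hgA, hgb⟩ := exists_positive_multiplier A c (0, 0, 1, 0, 0)
    (u, ⟨v, hv⟩, ⟨w, hw⟩) ((hb _).2 ⟨hu, hv, hw, h1, h2, h3, h4⟩) (by
      intro y hy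
      have h := hmin _ _ _ ((hb y).1 hy)
      rw [hobj _ _ hw, hobj _ _ y.2.2.continuous] at h
      exact h) (by
      rintro ⟨p, q, r, s, t⟩
      obtain ⟨M1, hM1⟩ := hbd hX0 p
      obtain ⟨M2, hM2⟩ := hbd hX q
      obtain ⟨M3, hM3⟩ := hbd hX r
      obtain ⟨M4, hM4⟩ := hbd hX s
      refine ⟨(max t M2, ContinuousMap.const _ M1, ContinuousMap.const _ (max M4 (M1 + M3))),
        fun x => hM1 x, fun x => ?_, fun x => ?_, fun x => ?_, le_max_left _ _⟩
      · change q x ≤ max t M2 + M1 - M1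
        linarith [hM2 x, le_max_right t M2]
      · change r x ≤ max M4 (M1 + M3) - M1
        linarith [hM3 x, le_max_right M4 (M1 + M3)]
      · exact (hM4 x).trans (le_max_left _ _))
  obtain ⟨μ₀, hμ₀, hμ₀c, hμ₀i⟩ := exists_measure_of_positive hX0
    (g.comp (LinearMap.inl ℝ _ _)) fun h hh => hg0 (h, 0, 0, 0, 0)
      ⟨hh, le_rfl, le_rfl, le_rfl, le_rfl⟩
  obtain ⟨ν, hν, hνc, hνi⟩ := exists_measure_of_positive hX
    (g.comp ((LinearMap.inr ℝ _ _).comp (LinearMap.inl ℝ _ _))) fun h hh => hg0 (0, h, 0, 0, 0)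
      ⟨le_rfl, hh, le_rfl, le_rfl, le_rfl⟩
  obtain ⟨μ, hμ, hμc, hμi⟩ := exists_measure_of_positive hX
    (g.comp ((LinearMap.inr ℝ _ _).comp ((LinearMap.inr ℝ _ _).comp (LinearMap.inl ℝ _ _))))
      fun h hh => hg0 (0, 0, h, 0, 0) ⟨le_rfl, le_rfl, hh, le_rfl, le_rfl⟩
  obtain ⟨μh, hμh, hμhc, hμhi⟩ := exists_measure_of_positive hX
    (g.comp ((LinearMap.inr ℝ _ _).comp ((LinearMap.inr ℝ _ _).comp
      ((LinearMap.inr ℝ _ _).comp (LinearMap.inl ℝ _ _)))))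
      fun h hh => hg0 (0, 0, 0, h, 0) ⟨le_rfl, le_rfl, le_rfl, hh, le_rfl⟩
  have ha : 0 ≤ g (0, 0, 0, 0, 1) := hg0 _ ⟨le_rfl, le_rfl, le_rfl, le_rfl, zero_le_one⟩
  have hsplit : ∀ (p : C(X0, ℝ)) (q r s : C(X, ℝ)) (t : ℝ), g (p, q, r, s, t) =
      g (p, 0, 0, 0, 0) + g (0, q, 0, 0, 0) + g (0, 0, r, 0, 0) + g (0, 0, 0, s, 0) +
        t * g (0, 0, 0, 0, 1) := by
    intro p q r s t
    rw [← smul_eq_mul, ← map_smul, ← map_add, ← map_add, ← map_add, ← map_add]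
    simp
  have key : ∀ (u : ℝ) (v w : C(Fin n → ℝ, ℝ)),
      ∫ x, v x ∂μ₀ + ∫ x, (u + v (f x) - v x) ∂ν + ∫ x, (w x - v x) ∂μ + ∫ x, w x ∂μh
        + u * g (0, 0, 0, 0, 1) = (∫ x in X, w x) + u * (T * volume.real X) := by
    intro u v w
    have e1 := hμ₀i v
    have e2 := hνi (ContinuousMap.const _ u + v.comp F - v)
    have e3 := hμi (w - v)
    have e4 := hμhi w
    have e5 := hgA (u, v, w)
    have e6 : g (A (u, v, w)) = _ := hsplit _ _ _ _ _
    simp only [ContinuousMap.add_apply, ContinuousMap.sub_apply, ContinuousMap.const_apply,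
      ContinuousMap.comp_apply] at e2 e3
    change ∫ x, (u + v (f x) - v x) ∂ν = _ at e2
    rw [e1, e2, e3, e4]
    exact e6.symm.trans e5
  have iν : ∀ {h : (Fin n → ℝ) → ℝ}, Continuous h → Integrable h ν :=
    integrable_of_continuous_of_compl_null hX hνc
  have iμ : ∀ {h : (Fin n → ℝ) → ℝ}, Continuous h → Integrable h μ :=
    integrable_of_continuous_of_compl_null hX hμc
  have iμ₀ : ∀ {h : (Fin n → ℝ) → ℝ}, Continuous h → Integrable h μ₀ :=
    integrable_of_continuous_of_compl_null hX0 hμ₀c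
  have iμh : ∀ {h : (Fin n → ℝ) → ℝ}, Continuous h → Integrable h μh :=
    integrable_of_continuous_of_compl_null hX hμhc
  refine ⟨μ₀, μ, μh, ν, ENNReal.ofReal (g (0, 0, 0, 0, 1)),
    ⟨hμ₀, hμ, hμh, hν, hμ₀c, hμc, hμhc, hνc, ?_, ?_, ?_⟩, ?_⟩
  · have h := key 1 0 0
    simp at h
    rw [← ENNReal.toReal_eq_toReal_iff' (by finiteness) (by finiteness),
      ENNReal.toReal_add (by finiteness) (by finiteness), ENNReal.toReal_ofReal ha,
      ENNReal.toReal_mul]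
    exact h
  · apply ext_of_forall_integral_eq_of_IsFiniteMeasure
    intro φ
    have h := key 0 φ.toContinuousMap 0
    simp only [zero_add, ContinuousMap.zero_apply, zero_sub, integral_zero, zero_mul, add_zero,
      integral_neg, BoundedContinuousFunction.coe_toContinuousMap] at h
    have hφf : Integrable (fun x => φ (f x)) ν := iν (φ.continuous.comp hf)
    rw [integral_sub hφf (iν φ.continuous)] at h
    rw [integral_add_measure (iμ φ.continuous) (iν φ.continuous),
      integral_add_measure (φ.integrable _) (iμ₀ φ.continuous),
      integral_map hf.aemeasurable φ.continuous.aestronglyMeasurable]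
    linarith
  · apply ext_of_forall_integral_eq_of_IsFiniteMeasure
    intro φ
    have h := key 0 0 φ.toContinuousMap
    simp at h
    rw [integral_add_measure (iμ φ.continuous) (iμh φ.continuous)]
    exact h
  · rw [hobj _ _ hw]
    have h := hμi 1
    simp at h
    exact h.trans hgb

/-- In a balance equation, no mass is produced outside a forward invariant set containing the
initial conditions. -/
theorem measure_compl_eq_zero_of_balance {E : Type*} [MeasurableSpace E] {f : E → E}
    (hf : Measurable f) {μ ν μ₀ : Measure E} [IsFiniteMeasure ν] {s : Set E}
    (hs : MeasurableSet s) (hinv : Set.MapsTo f s s) (hμ₀ : μ₀ sᶜ = 0)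
    (h : μ + ν = Measure.map f ν + μ₀) : μ sᶜ = 0 := by
  have h1 := congrArg (fun m : Measure E => m sᶜ) h
  simp only [Measure.add_apply, hμ₀, add_zero, Measure.map_apply hf hs.compl] at h1
  have h2 : ν (f ⁻¹' sᶜ) ≤ ν sᶜ := measure_mono fun x hx hxs => hx (hinv hxs)
  rw [← h1] at h2
  exact nonpos_iff_eq_zero.1 (ENNReal.le_of_add_le_add_right (measure_ne_top ν _)
    (by simpa using h2))

/-- In a balance equation, the mass of `ν` bounds the mean hitting time under `μ`. -/
theorem tsum_measure_compl_le_of_balance {E : Type*} [MeasurableSpace E] {f : E → E}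
    (hf : Measurable f) {μ ν μ₀ : Measure E} {S : ℕ → Set E} (hS : ∀ t, MeasurableSet (S t))
    (hmaps : ∀ t, Set.MapsTo f (S t) (S (t + 1))) (hμ₀ : ∀ t, μ₀ (S (t + 1))ᶜ = 0)
    (h : μ + ν = Measure.map f ν + μ₀) :
    ∑' t, μ (S (t + 1))ᶜ ≤ ν Set.univ := by
  have step : ∀ t, μ (S (t + 1))ᶜ + ν (S (t + 1))ᶜ ≤ ν (S t)ᶜ := by
    intro t
    have h1 := congrArg (fun m : Measure E => m (S (t + 1))ᶜ) h
    simp only [Measure.add_apply, hμ₀, add_zero, Measure.map_apply hf (hS _).compl] at h1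
    rw [h1]
    exact measure_mono fun x hx hxs => hx (hmaps t hxs)
  have hsum : ∀ N, ∑ t ∈ Finset.range N, μ (S (t + 1))ᶜ + ν (S N)ᶜ ≤ ν Set.univ := by
    intro N
    induction N with
    | zero => simpa using measure_mono (Set.subset_univ _)
    | succ N ih =>
      rw [Finset.sum_range_succ, add_assoc]
      exact (add_le_add_right (step N) _).trans ih
  exact ENNReal.tsum_le_of_sum_range_le fun N => le_self_add.trans (hsum N)

theorem tsum_nat_mul_measure_le {E : Type*} [MeasurableSpace E] (μ : Measure E)
    {Y R : ℕ → Set E} (hY : ∀ t, MeasurableSet (Y t))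
    (hdisj : Pairwise (Function.onFun Disjoint Y)) (hYR : ∀ s t, s < t → Y t ⊆ R s) :
    ∑' t : ℕ, (t : ℝ≥0∞) * μ (Y t) ≤ ∑' s, μ (R s) := by
  have h1 : ∀ t : ℕ, (t : ℝ≥0∞) * μ (Y t) = ∑' s, if s < t then μ (Y t) else 0 := by
    intro t
    rw [tsum_eq_sum (s := Finset.range t) (by simp +contextual),
      Finset.sum_congr rfl fun s hs => if_pos (Finset.mem_range.1 hs)]
    simp
  simp_rw [h1]
  rw [ENNReal.tsum_comm]
  refine ENNReal.tsum_le_tsum fun s => ?_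
  have h2 : ∀ t, (if s < t then μ (Y t) else 0) = μ (if s < t then Y t else ∅) := by
    intro t; split_ifs <;> simp
  simp_rw [h2]
  rw [← measure_iUnion]
  · refine measure_mono (Set.iUnion_subset fun t => ?_)
    split_ifs with h
    exacts [hYR s t h, Set.empty_subset _]
  · intro a b hab
    refine (hdisj hab).mono ?_ ?_ <;> dsimp only <;> split_ifs <;> simp
  · intro t
    split_ifs
    exacts [hY t, MeasurableSet.empty]

theorem measure_le_integral_of_one_le {E : Type*} [TopologicalSpace E] [MeasurableSpace E]
    {m : Measure E} {K S : Set E} (hK : MeasurableSet K) (hS : MeasurableSet S) (hSK : S ⊆ K)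
    (hKfin : m K ≠ ⊤) {w : E → ℝ} (hint : IntegrableOn w K m) (h0 : ∀ x ∈ K, 0 ≤ w x)
    (h1 : ∀ x ∈ S, 1 ≤ w x) : (m S).toReal ≤ ∫ x in K, w x ∂m := by
  calc (m S).toReal = ∫ _ in S, (1 : ℝ) ∂m := by simp [Measure.real]
    _ ≤ ∫ x in S, w x ∂m := by
        refine setIntegral_mono_on ?_ (hint.mono_set hSK) hS h1
        exact integrableOn_const (measure_ne_top_of_subset hSK hKfin)
    _ ≤ ∫ x in K, w x ∂m := setIntegral_mono_set hint
        ((ae_restrict_iff' hK).2 (Filter.Eventually.of_forall h0)) hSK.eventuallyLE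

/-- If the dual LP admits an optimal feasible point with `u = 0`, then
`∑_t t · vol Y^t ≤ T · vol X` and `p^T = d^T = vol X^∞`. -/
theorem dual_u_zero (n : ℕ) (hn : 1 ≤ n)
    (f : (Fin n → ℝ) → (Fin n → ℝ))
    (hfpoly : ∀ i, ∃ p : MvPolynomial (Fin n) ℝ, ∀ x, f x i = MvPolynomial.eval x p)
    (X0 X : Set (Fin n → ℝ)) (hX0 : IsCompact X0) (hX : IsCompact X)
    (hreach : (⋃ t : ℕ, f^[t] '' X0) ⊆ X)
    (Y : ℕ → Set (Fin n → ℝ))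
    (hY0 : Y 0 = X0)
    (hYt : ∀ t : ℕ, 1 ≤ t → Y t = f^[t] '' X0 \ ⋃ s ∈ Finset.range t, f^[s] '' X0)
    (hclos : volume (⋃ t : ℕ, f^[t] '' X0) = volume (closure (⋃ t : ℕ, f^[t] '' X0)))
    (T : ℕ) (hT : 1 ≤ T)
    (v w : (Fin n → ℝ) → ℝ)
    (hfeas : DualFeasible n f X0 X 0 v w)
    (hopt : (∫ x in X, w x) = dualValue n f X0 X T) :
    (∑' t : ℕ, (t : ℝ≥0∞) * volume (Y t)) ≤ (T : ℝ≥0∞) * volume X ∧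
      primalValue n f X0 X T = dualValue n f X0 X T ∧
      dualValue n f X0 X T = (volume (⋃ t : ℕ, f^[t] '' X0)).toReal := by
  have hf : Continuous f := by
    refine continuous_pi fun i => ?_
    obtain ⟨p, hp⟩ := hfpoly i
    simpa only [hp] using MvPolynomial.continuous_eval p
  have hm : ∀ t, MeasurableSet (f^[t] '' X0) := fun t =>
    (hX0.image (hf.iterate t)).measurableSet
  have hXfin : volume X ≠ ⊤ := hX.measure_lt_top.ne
  have hmaps : ∀ t, Set.MapsTo f (f^[t] '' X0) (f^[t + 1] '' X0) := by
    rintro t _ ⟨x, hx, rfl⟩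
    exact ⟨x, hx, Function.iterate_succ_apply' f t x⟩
  set A := ⋃ t : ℕ, f^[t] '' X0 with hA
  have hAm : MeasurableSet A := MeasurableSet.iUnion hm
  have hAinv : Set.MapsTo f A A := fun x hx => by
    obtain ⟨t, ht⟩ := Set.mem_iUnion.1 hx
    exact Set.mem_iUnion.2 ⟨t + 1, hmaps t ht⟩
  have hX0A : X0 ⊆ A := fun x hx => Set.mem_iUnion.2 ⟨0, x, hx, rfl⟩
  have hAfin : volume A ≠ ⊤ := measure_ne_top_of_subset hreach hXfin
  have hnull : ∀ μ₀ μ μh ν a, PrimalFeasible n f X0 X T μ₀ μ μh ν a → μ Aᶜ = 0 := by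
    rintro μ₀ μ μh ν a ⟨-, -, -, hν, hμ₀, -, -, -, -, hbal, -⟩
    exact measure_compl_eq_zero_of_balance hf.measurable hAm hAinv
      (measure_mono_null (Set.compl_subset_compl.2 hX0A) hμ₀) hbal
  have hle : ∀ μ₀ μ μh ν a, PrimalFeasible n f X0 X T μ₀ μ μh ν a →
      μ ≤ volume.restrict A := by
    intro μ₀ μ μh ν a h
    have h1 : μ ≤ volume.restrict X := h.2.2.2.2.2.2.2.2.2.2 ▸ Measure.le_add_right le_rfl
    have h2 := Measure.restrict_mono_measure h1 A
    have h3 : μ.restrict A = μ := Measure.restrict_eq_self_of_ae_mem (hnull _ _ _ _ _ h)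
    rwa [h3, Measure.restrict_restrict hAm, Set.inter_eq_left.2 hreach] at h2
  obtain ⟨-, hv, hw, h1, h2, h3, h4⟩ := id hfeas
  have hvA : ∀ x ∈ A, 0 ≤ v x := by
    suffices ∀ t, ∀ x ∈ f^[t] '' X0, 0 ≤ v x from
      fun x hx => (Set.mem_iUnion.1 hx).elim fun t ht => this t x ht
    intro t
    induction t with
    | zero => simpa using h1
    | succ t ih =>
      rintro _ ⟨x, hx, rfl⟩
      have hmem : f^[t] x ∈ f^[t] '' X0 := ⟨x, hx, rfl⟩
      have h := h4 _ (hreach (Set.mem_iUnion.2 ⟨t, hmem⟩))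
      rw [Function.iterate_succ_apply']
      linarith [ih _ hmem]
  have hwA : ∀ x ∈ closure A, 1 ≤ w x :=
    closure_minimal (fun x hx => (by linarith [hvA x hx, h2 x (hreach hx)] : 1 ≤ w x))
      (isClosed_le continuous_const hw)
  have hlow : (volume A).toReal ≤ ∫ x in X, w x := by
    rw [hclos]
    exact measure_le_integral_of_one_le hX.measurableSet isClosed_closure.measurableSet
      (closure_minimal hreach hX.isClosed) hXfin (hw.continuousOn.integrableOn_compact hX) h3 hwA
  obtain ⟨μ₀, μ, μh, ν, a, hfe, hval⟩ := exists_primalFeasible_of_dual_minimizer hf hX0 hX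
    (T := T) hfeas (by
      intro u' v' w' h
      simp only [mul_zero, add_zero, hopt]
      refine csInf_le ⟨0, ?_⟩ ⟨u', v', w', h, rfl⟩
      rintro _ ⟨u, v, w, ⟨hu, -, -, -, -, hw, -⟩, rfl⟩
      exact setIntegral_nonneg hX.measurableSet fun x hx =>
        add_nonneg (hw x hx) (mul_nonneg T.cast_nonneg hu))
  simp only [mul_zero, add_zero] at hval
  have hup : ∀ μ₀ μ μh ν a, PrimalFeasible n f X0 X T μ₀ μ μh ν a →
      (μ Set.univ).toReal ≤ (volume A).toReal := by
    intro μ₀ μ μh ν a h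
    exact ENNReal.toReal_mono hAfin (by simpa using hle _ _ _ _ _ h Set.univ)
  have hd : ∫ x in X, w x = (volume A).toReal :=
    le_antisymm (hval ▸ hup _ _ _ _ _ hfe) hlow
  have : IsFiniteMeasure μ := hfe.2.1
  have hμ : μ = volume.restrict A := by
    refine Measure.eq_of_le_of_measure_univ_eq (hle _ _ _ _ _ hfe) ?_
    rw [Measure.restrict_apply_univ, ← ENNReal.toReal_eq_toReal_iff' (measure_ne_top _ _) hAfin,
      hval, hd]
  refine ⟨?_, ?_, hopt ▸ hd⟩
  · obtain ⟨-, -, -, -, hμ₀, -, -, -, hmass, hbal, -⟩ := hfe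
    let S : ℕ → Set (Fin n → ℝ) := fun t => ⋃ s ∈ Finset.range t, f^[s] '' X0
    have hSm : ∀ t, MeasurableSet (S t) := fun t =>
      Finset.measurableSet_biUnion _ fun s _ => hm s
    have hSY : ∀ t, Y t = f^[t] '' X0 \ S t := by
      intro t
      rcases t.eq_zero_or_pos with rfl | ht
      · simp [S, hY0]
      · exact hYt t ht
    have hYS : ∀ s t, s < t → Y t ⊆ (S (s + 1))ᶜ := by
      intro s t hst x hx
      rw [hSY] at hx
      exact fun hxs => hx.2 (Set.biUnion_subset_biUnion_left
        (Finset.range_subset_range.2 hst) hxs)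
    have hdisj : Pairwise (Function.onFun Disjoint Y) := by
      refine (pairwise_disjoint_on Y).2 fun s t hst => ?_
      refine Set.disjoint_left.2 fun x hxs hxt => hYS s t hst hxt ?_
      rw [hSY] at hxs
      exact Set.mem_biUnion (Finset.mem_coe.2 (Finset.self_mem_range_succ s)) hxs.1
    have hYm : ∀ t, MeasurableSet (Y t) := fun t => hSY t ▸ (hm t).diff (hSm t)
    have hYμ : ∀ t, volume (Y t) = μ (Y t) := by
      intro t
      rw [hμ, Measure.restrict_eq_self]
      rw [hSY]
      exact Set.sdiff_subset.trans (Set.subset_iUnion (fun t => f^[t] '' X0) t)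
    simp_rw [hYμ]
    refine (tsum_nat_mul_measure_le μ hYm hdisj hYS).trans
      ((tsum_measure_compl_le_of_balance hf.measurable hSm ?_ ?_ hbal).trans
        (hmass ▸ le_self_add))
    · intro t x hx
      obtain ⟨s, hs, hx⟩ := Set.mem_iUnion₂.1 hx
      exact Set.mem_biUnion (Finset.mem_coe.2
        (Finset.mem_range.2 (Nat.succ_lt_succ (Finset.mem_range.1 hs)))) (hmaps s hx)
    · intro t
      refine measure_mono_null (Set.compl_subset_compl.2 fun x hx => ?_) hμ₀
      exact Set.mem_biUnion (Finset.mem_coe.2 (Finset.mem_range.2 t.succ_pos)) ⟨x, hx, rfl⟩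
  · rw [← hopt]
    refine IsGreatest.csSup_eq ⟨⟨μ₀, μ, μh, ν, a, hfe, hval.symm⟩, ?_⟩
    rintro _ ⟨μ₀', μ', μh', ν', a', h, rfl⟩
    exact (hup _ _ _ _ _ h).trans hd.ge
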